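/- arXiv:1611.01478 — 3 statements merged into one kernel-verified Lean document; each statement's English description precedes it below -/
import Mathlib

section
/- For integers n ≥ 1 and 0 ≤ k ≤ ⌊(n-1)/2⌋, the number of increasing unary-binary trees with n vertices whose associated permutation avoids 213 and that have exactly n-1-2k unary nodes is equal to (1/n)·binomial(2n, k)·binomial(n-k, k+1). -/
/-- A sequence (list) avoids the pattern 213. -/
def Avoids213 (s : List ℕ) : Prop :=
  ∀ i1 i2 i3, i1 < i2 → i2 < i3 → i3 < s.length →
    ¬ (s.getD i2 0 < s.getD i1 0 ∧ s.getD i1 0 < s.getD i3 0)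
/-- Labeled unary-binary trees: each vertex carries a label and has 0, 1 or 2 children. -/
inductive UBTree where
  | lf : ℕ → UBTree
  | un : ℕ → UBTree → UBTree
  | bin : ℕ → UBTree → UBTree → UBTree

/-- Number of vertices. -/
def UBTree.size : UBTree → ℕ
  | .lf _ => 1
  | .un _ t => 1 + t.size
  | .bin _ l r => 1 + l.size + r.size

/-- Root label. -/
def UBTree.label : UBTree → ℕ
  | .lf a => a
  | .un a _ => a
  | .bin a _ _ => a

/-- Ordered list of children (subtrees) of the root. -/
def UBTree.children : UBTree → List UBTree
  | .lf _ => []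
  | .un _ t => [t]
  | .bin _ l r => [l, r]

/-- The labeling is increasing: every child has a larger label than its parent. -/
def UBTree.increasing : UBTree → Prop
  | .lf _ => True
  | .un a t => a < t.label ∧ t.increasing
  | .bin a l r => a < l.label ∧ a < r.label ∧ l.increasing ∧ r.increasing

/-- Number of unary nodes (vertices with exactly one child). -/
def UBTree.unaryCount : UBTree → ℕ
  | .lf _ => 0
  | .un _ t => 1 + t.unaryCount
  | .bin _ l r => l.unaryCount + r.unaryCount

/-- Breadth-first traversal of a queue of trees, recording `f` at each vertex;
the fuel bounds the number of vertices processed. -/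
def bfsAux (f : UBTree → ℕ) : ℕ → List UBTree → List ℕ
  | 0, _ => []
  | _ + 1, [] => []
  | n + 1, t :: ts => f t :: bfsAux f n (ts ++ t.children)

/-- Labels of the tree read in left-to-right breadth-first search order
(the fuel `t.size` is exactly the number of vertices, hence suffices). -/
def UBTree.bfs (t : UBTree) : List ℕ := bfsAux UBTree.label t.size [t]

/-- Arities (numbers of children) of the vertices read in left-to-right
breadth-first search order. -/
def UBTree.bfsArity (t : UBTree) : List ℕ :=
  bfsAux (fun t => t.children.length) t.size [t]

/-- An increasing unary-binary tree (vertices labeled bijectively with `1, ..., n`,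
children having larger labels than their parents) whose associated permutation
(labels in breadth-first search order) avoids the pattern 213. -/
def IsGoodUB (t : UBTree) : Prop :=
  t.increasing ∧ t.bfs.Perm (List.range' 1 t.size) ∧ Avoids213 t.bfs

/-- Number of ways to complete a partial word with `r` further vertices prepended: `m` is the
number of admissible labels for a new leaf, `q` the current queue length and `c` the number of
unary vertices so far; the completed word must have queue length `1` and `U` unary vertices. -/
def completions (U : ℕ) : ℕ → ℕ → ℕ → ℕ → ℕ
  | 0, _, q, c => if q = 1 ∧ c = U then 1 else 0
  | r + 1, m, q, c =>
      (∑ i ∈ Finset.range m, completions U r (i + 2) (q + 1) c)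
        + (if 1 ≤ q then completions U r 2 q (c + 1) else 0)
        + (if 2 ≤ q then completions U r 2 (q - 1) c else 0)

theorem completions_eq_zero (U : ℕ) :
    ∀ r m q c, (U < c ∨ r + 1 + c < q + U) → completions U r m q c = 0 := by
  intro r
  induction r with
  | zero =>
    intro m q c h
    rw [completions, if_neg]
    omega
  | succ r ih =>
    intro m q c h
    rw [completions, Finset.sum_eq_zero (fun i _ => ih _ _ _ (by omega))]
    have h1 : (if 1 ≤ q then completions U r 2 q (c + 1) else 0) = 0 := by
      split_ifs
      · exact ih _ _ _ (by omega)
      · rfl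
    have h2 : (if 2 ≤ q then completions U r 2 (q - 1) c else 0) = 0 := by
      split_ifs
      · exact ih _ _ _ (by omega)
      · rfl
    rw [h1, h2]

/-- The binomial coefficient `N.choose (l - 1)`, equal to `0` for `l = 0`. -/
def choosePred (N : ℕ) : ℕ → ℕ
  | 0 => 0
  | l + 1 => N.choose l

theorem choosePred_succ (N l : ℕ) :
    choosePred (N + 1) (l + 1) = choosePred N (l + 1) + choosePred N l := by
  cases l with
  | zero => simp [choosePred]
  | succ l =>
    simp only [choosePred]
    rw [Nat.choose_succ_succ]
    exact Nat.add_comm _ _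

/-- Closed form for the number of completions by `u` unary vertices, `b` binary vertices and
`l` leaves. -/
def completionsFormula (m u b l : ℕ) : ℤ :=
  (u + b).choose b * (((2 * l + 2 * (u + b) + m - 1).choose l : ℤ)
      - choosePred (2 * l + 2 * (u + b) + m - 1) l)
    - 2 * (u + b + 1).choose (b + 1) * choosePred (2 * l + 2 * (u + b) + m - 1) l

theorem completionsFormula_leaves_zero (m u b : ℕ) :
    completionsFormula m u b 0 = (u + b).choose b := by
  simp [completionsFormula, choosePred]

theorem completionsFormula_succ (m u b l : ℕ) :
    completionsFormula (m + 1) u b (l + 1) =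
      completionsFormula m u b (l + 1) + completionsFormula (m + 2) u b l := by
  have h1 : 2 * (l + 1) + 2 * (u + b) + (m + 1) - 1 = 2 * l + 2 * (u + b) + m + 1 + 1 := by omega
  have h2 : 2 * (l + 1) + 2 * (u + b) + m - 1 = 2 * l + 2 * (u + b) + m + 1 := by omega
  have h3 : 2 * l + 2 * (u + b) + (m + 2) - 1 = 2 * l + 2 * (u + b) + m + 1 := by omega
  simp only [completionsFormula, h1, h2, h3, choosePred_succ, Nat.choose_succ_succ _ l]
  push_cast
  ring

theorem completionsFormula_boundary (u b : ℕ) : completionsFormula 2 u b (b + 1) = 0 := by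
  have h : 2 * (b + 1) + 2 * (u + b) + 2 - 1 = 2 * u + 4 * b + 3 := by omega
  have h1 := Nat.choose_succ_right_eq (2 * u + 4 * b + 3) b
  have h2 := Nat.add_one_mul_choose_eq (u + b) b
  simp only [completionsFormula, h, choosePred]
  have h3 : 2 * u + 4 * b + 3 - b = 2 * u + 3 * b + 3 := by omega
  rw [h3] at h1
  have h4 : ((b : ℤ) + 1) ≠ 0 := by positivity
  zify at h1 h2
  apply mul_left_cancel₀ h4
  linear_combination ((u + b).choose b : ℤ) * h1
    + 2 * ((2 * u + 4 * b + 3).choose b : ℤ) * h2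

theorem completionsFormula_head (u b l : ℕ) :
    completionsFormula 0 (u + 1) (b + 1) l =
      completionsFormula 2 u (b + 1) l + completionsFormula 2 (u + 1) b l := by
  have h1 : 2 * l + 2 * (u + 1 + (b + 1)) + 0 - 1 = 2 * l + 2 * (u + b + 1) + 1 := by omega
  have h2 : 2 * l + 2 * (u + (b + 1)) + 2 - 1 = 2 * l + 2 * (u + b + 1) + 1 := by omega
  have h3 : 2 * l + 2 * (u + 1 + b) + 2 - 1 = 2 * l + 2 * (u + b + 1) + 1 := by omega
  have h4 : u + 1 + (b + 1) = u + b + 1 + 1 := by omega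
  have h5 : u + (b + 1) = u + b + 1 := by omega
  have h6 : u + 1 + b = u + b + 1 := by omega
  simp only [completionsFormula, h1, h2, h3]
  rw [h4, h5, h6, Nat.choose_succ_succ' (u + b + 1 + 1) (b + 1),
    Nat.choose_succ_succ' (u + b + 1) b]
  push_cast
  ring

theorem completionsFormula_head_of_no_unary (b l : ℕ) :
    completionsFormula 0 0 (b + 1) l = completionsFormula 2 0 b l := by
  have h1 : 2 * l + 2 * (0 + (b + 1)) + 0 - 1 = 2 * l + 2 * b + 1 := by omega
  have h2 : 2 * l + 2 * (0 + b) + 2 - 1 = 2 * l + 2 * b + 1 := by omega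
  simp only [completionsFormula, h1, h2]
  simp

theorem completions_eq_formula (U : ℕ) : ∀ r m u b l c q, r = u + b + l → q + l = b + 1 → 1 ≤ q →
    u + c = U → (completions U r m q c : ℤ) = completionsFormula m u b l := by
  intro r
  induction r with
  | zero =>
    intro m u b l c q hr hq hq1 hc
    obtain rfl : u = 0 := by omega
    obtain rfl : b = 0 := by omega
    obtain rfl : l = 0 := by omega
    rw [completions, if_pos (by omega), completionsFormula_leaves_zero]
    simp
  | succ r ih =>
    intro m
    induction m with
    | zero =>
      intro u b l c q hr hq hq1 hc
      have unary : (completions U r 2 q (c + 1) : ℤ) =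
          if u = 0 then 0 else completionsFormula 2 (u - 1) b l := by
        split_ifs with hu
        · rw [completions_eq_zero U _ _ _ _ (by omega)]
          rfl
        · exact ih _ _ _ _ _ _ (by omega) (by omega) (by omega) (by omega)
      have binary : ((if 2 ≤ q then completions U r 2 (q - 1) c else 0 : ℕ) : ℤ) =
          if b = 0 then 0 else completionsFormula 2 u (b - 1) l := by
        split_ifs with h2 hb hb
        · omega
        · exact ih _ _ _ _ _ _ (by omega) (by omega) (by omega) (by omega)
        · rfl
        · have h := completionsFormula_boundary u (b - 1)
          rw [show b - 1 + 1 = l by omega] at h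
          rw [h]
          rfl
      rw [completions, Finset.sum_range_zero, if_pos hq1]
      push_cast [unary, binary]
      rcases u with _ | u <;> rcases b with _ | b
      · omega
      · simp [completionsFormula_head_of_no_unary]
      · obtain rfl : l = 0 := by omega
        simp [completionsFormula_leaves_zero]
      · simp [completionsFormula_head]
    | succ m ihm =>
      intro u b l c q hr hq hq1 hc
      have leaf : completions U (r + 1) (m + 1) q c =
          completions U (r + 1) m q c + completions U r (m + 2) (q + 1) c := by
        rw [completions, completions, Finset.sum_range_succ]
        ring
      rw [leaf, Nat.cast_add, ihm u b l c q hr hq hq1 hc]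
      rcases l with _ | l
      · rw [completions_eq_zero U _ _ _ _ (by omega)]
        simp [completionsFormula_leaves_zero]
      · rw [ih (m + 2) u b l c (q + 1) (by omega) (by omega) (by omega) hc,
          completionsFormula_succ]

theorem mul_completions (n k : ℕ) (hn : 1 ≤ n) (hk : k ≤ (n - 1) / 2) :
    n * completions (n - 1 - 2 * k) n 1 0 0 = (2 * n).choose k * (n - k).choose (k + 1) := by
  obtain ⟨u, rfl⟩ : ∃ u, n = u + 2 * k + 1 := ⟨n - 1 - 2 * k, by omega⟩
  have hu : u + 2 * k + 1 - 1 - 2 * k = u := by omega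
  have hU : completions u (u + 2 * k + 1) 1 0 0 = completions u (u + 2 * k) 2 1 0 := by
    simp [completions]
  have hF := completions_eq_formula u (u + 2 * k) 2 u k k 0 1 (by omega) (by omega) le_rfl rfl
  have hsub : u + 2 * k + 1 - k = u + k + 1 := by omega
  rw [hu, hU, hsub]
  zify
  rw [hF, completionsFormula]
  have hN : 2 * k + 2 * (u + k) + 2 - 1 = 2 * u + 4 * k + 1 := by omega
  have hN' : 2 * (u + 2 * k + 1) = 2 * u + 4 * k + 1 + 1 := by omega
  rw [hN, hN']
  rcases k with _ | k
  · simp [choosePred]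
  · have h1 := Nat.choose_succ_right_eq (2 * u + 4 * (k + 1) + 1) k
    have h2 := Nat.add_one_mul_choose_eq (u + (k + 1)) (k + 1)
    have h3 : 2 * u + 4 * (k + 1) + 1 - k = 2 * u + 3 * k + 5 := by omega
    rw [h3] at h1
    rw [Nat.choose_succ_succ' (2 * u + 4 * (k + 1) + 1) k]
    simp only [choosePred]
    have h4 : ((k : ℤ) + 1) ≠ 0 := by positivity
    zify at h1 h2
    push_cast
    generalize ((2 * u + 4 * (k + 1) + 1).choose k : ℤ) = x at *
    generalize ((2 * u + 4 * (k + 1) + 1).choose (k + 1) : ℤ) = y at *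
    generalize ((u + (k + 1)).choose (k + 1) : ℤ) = z at *
    generalize ((u + (k + 1) + 1).choose (k + 1 + 1) : ℤ) = t at *
    apply mul_left_cancel₀ h4
    linear_combination (((u : ℤ) + 2 * k + 3) * z - t) * h1 + 2 * ((u : ℤ) + 2 * k + 3) * x * h2

/-- Queue length needed to read the word: the number of trees of the forest it encodes. -/
def queueLength : List (ℕ × ℕ) → ℕ
  | [] => 0
  | p :: w => queueLength w + 1 - p.2

/-- Words of pairs (label, arity) that encode increasing forests avoiding 213 in breadth-first
order: an internal vertex is smaller than everything after it. -/
def IsForestWord : List (ℕ × ℕ) → Prop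
  | [] => True
  | p :: w => IsForestWord w ∧ w.Pairwise (fun x y => ¬(x.1 < p.1 ∧ p.1 < y.1)) ∧
      (p.2 ≠ 0 → ∀ x ∈ w, p.1 < x.1) ∧ p.2 ≤ queueLength w ∧ p.2 ≤ 2

/-- Forest words labeled bijectively with `1, ..., w.length`. -/
def IsStandardWord (w : List (ℕ × ℕ)) : Prop :=
  IsForestWord w ∧ (w.map Prod.fst).Nodup ∧
    ∀ x, x ∈ w.map Prod.fst ↔ 1 ≤ x ∧ x ≤ w.length

/-- The increasing map `ℕ → ℕ` whose range misses exactly `a`. -/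
def bump (a x : ℕ) : ℕ := if a ≤ x then x + 1 else x

theorem bump_strictMono (a : ℕ) : StrictMono (bump a) := by
  intro x y h
  unfold bump
  split_ifs <;> omega

theorem bump_ne (a x : ℕ) : bump a x ≠ a := by
  unfold bump
  split_ifs <;> omega

theorem bump_lt_iff (a x : ℕ) : bump a x < a ↔ x < a := by
  unfold bump
  split_ifs <;> omega

theorem lt_bump_iff (a x : ℕ) : a < bump a x ↔ a ≤ x := by
  unfold bump
  split_ifs <;> omega

theorem exists_bump_eq {a x : ℕ} (h : x ≠ a) : ∃ y, bump a y = x := by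
  rcases Nat.lt_or_gt_of_ne h with h | h
  · exact ⟨x, by unfold bump; split_ifs <;> omega⟩
  · exact ⟨x - 1, by unfold bump; split_ifs <;> omega⟩

/-- Rewrite the labels of a word along `f`. -/
def mapLabels (f : ℕ → ℕ) (w : List (ℕ × ℕ)) : List (ℕ × ℕ) := w.map (Prod.map f id)

theorem queueLength_mapLabels (f : ℕ → ℕ) (w : List (ℕ × ℕ)) :
    queueLength (mapLabels f w) = queueLength w := by
  induction w with
  | nil => rfl
  | cons p w ih =>
    simp only [mapLabels, List.map_cons, queueLength] at ih ⊢
    rw [ih]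
    rfl

theorem isForestWord_mapLabels {f : ℕ → ℕ} (hf : StrictMono f) (w : List (ℕ × ℕ)) :
    IsForestWord (mapLabels f w) ↔ IsForestWord w := by
  induction w with
  | nil => rfl
  | cons p w ih =>
    have hq := queueLength_mapLabels f w
    simp only [mapLabels] at ih hq
    simp only [mapLabels, List.map_cons, IsForestWord, ih, hq, List.pairwise_map, Prod.map_fst,
      Prod.map_snd, id_eq, hf.lt_iff_lt, List.forall_mem_map]

theorem map_fst_mapLabels (f : ℕ → ℕ) (w : List (ℕ × ℕ)) :
    (mapLabels f w).map Prod.fst = (w.map Prod.fst).map f := by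
  simp [mapLabels, Function.comp_def]

/-- Prepend a vertex of label `a` and arity `k`, making room for the label `a`. -/
def prepend (a k : ℕ) (w : List (ℕ × ℕ)) : List (ℕ × ℕ) := (a, k) :: mapLabels (bump a) w

/-- Labels that can be prepended to a standard word without creating the pattern 213. -/
def leafLabels (w : List (ℕ × ℕ)) : Finset ℕ :=
  {a ∈ Finset.Icc 1 (w.length + 1) | w.Pairwise (fun x y => ¬(x.1 < a ∧ a ≤ y.1))}

theorem mem_leafLabels {a : ℕ} {w : List (ℕ × ℕ)} : a ∈ leafLabels w ↔
    (1 ≤ a ∧ a ≤ w.length + 1) ∧ w.Pairwise (fun x y => ¬(x.1 < a ∧ a ≤ y.1)) := by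
  rw [leafLabels, Finset.mem_filter, Finset.mem_Icc]

/-- Pairs (label, arity) that can be prepended to a standard word. -/
def headChoices (w : List (ℕ × ℕ)) : Finset (ℕ × ℕ) :=
  {p ∈ leafLabels w ×ˢ Finset.range 3 | p.2 ≤ queueLength w ∧ (p.2 ≠ 0 → p.1 = 1)}

theorem exists_eq_prepend {a k : ℕ} {v : List (ℕ × ℕ)}
    (h : (((a, k) :: v).map Prod.fst).Nodup) : ∃ w, prepend a k w = (a, k) :: v := by
  have hv : ∀ p ∈ v, p.1 ≠ a := by
    intro p hp hpa
    exact (List.nodup_cons.1 h).1 (List.mem_map.2 ⟨p, hp, hpa⟩)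
  suffices ∃ w, mapLabels (bump a) w = v by
    obtain ⟨w, rfl⟩ := this
    exact ⟨w, rfl⟩
  clear h
  induction v with
  | nil => exact ⟨[], rfl⟩
  | cons p v ih =>
    obtain ⟨w, hw⟩ := ih fun p hp => hv p (List.mem_cons_of_mem _ hp)
    obtain ⟨y, hy⟩ := exists_bump_eq (hv p List.mem_cons_self)
    refine ⟨(y, p.2) :: w, ?_⟩
    simp only [mapLabels] at hw
    simp [mapLabels, hw, hy]

theorem mapLabels_bump_injective (a : ℕ) : Function.Injective (mapLabels (bump a)) :=
  List.map_injective_iff.2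
    (Function.Injective.prodMap (bump_strictMono a).injective Function.injective_id)

theorem isStandardWord_prepend_iff (a k : ℕ) (w : List (ℕ × ℕ)) :
    IsStandardWord (prepend a k w) ↔ IsStandardWord w ∧ (a, k) ∈ headChoices w := by
  have hlen : (prepend a k w).length = w.length + 1 := by simp [prepend, mapLabels]
  have hlab : (prepend a k w).map Prod.fst = a :: (w.map Prod.fst).map (bump a) := by
    rw [prepend, List.map_cons, map_fst_mapLabels]
  have hpw : (mapLabels (bump a) w).Pairwise (fun x y => ¬(x.1 < a ∧ a < y.1)) ↔
      w.Pairwise (fun x y => ¬(x.1 < a ∧ a ≤ y.1)) := by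
    simp only [mapLabels, List.pairwise_map, Prod.map_fst, bump_lt_iff, lt_bump_iff]
  have hall : (∀ x ∈ mapLabels (bump a) w, a < x.1) ↔ ∀ x ∈ w.map Prod.fst, a ≤ x := by
    simp only [mapLabels, List.forall_mem_map, Prod.map_fst, lt_bump_iff]
  have hnodup : (a :: (w.map Prod.fst).map (bump a)).Nodup ↔ (w.map Prod.fst).Nodup := by
    rw [List.nodup_cons, List.nodup_map_iff (bump_strictMono a).injective]
    refine and_iff_right ?_
    rw [List.mem_map]
    rintro ⟨y, -, hy⟩
    exact bump_ne a y hy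
  have hmem : (∀ x, x ∈ a :: (w.map Prod.fst).map (bump a) ↔ 1 ≤ x ∧ x ≤ w.length + 1) ↔
      (1 ≤ a ∧ a ≤ w.length + 1) ∧ ∀ x, x ∈ w.map Prod.fst ↔ 1 ≤ x ∧ x ≤ w.length := by
    simp only [List.mem_cons, List.mem_map (f := bump a)]
    generalize w.map Prod.fst = l
    generalize w.length = N
    constructor
    · intro h
      have ha := (h a).1 (Or.inl rfl)
      refine ⟨ha, fun x => ⟨fun hx => ?_, fun hx => ?_⟩⟩
      · have := (h (bump a x)).1 (Or.inr ⟨x, hx, rfl⟩)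
        unfold bump at this
        split_ifs at this <;> omega
      · have hb : 1 ≤ bump a x ∧ bump a x ≤ N + 1 := by
          unfold bump
          split_ifs <;> omega
        rcases (h _).2 hb with h' | ⟨y, hy, hyx⟩
        · exact absurd h' (bump_ne a x)
        · rwa [← (bump_strictMono a).injective hyx]
    · rintro ⟨ha, h⟩ x
      constructor
      · rintro (rfl | ⟨y, hy, rfl⟩)
        · exact ha
        · have := (h y).1 hy
          unfold bump
          split_ifs <;> omega
      · intro hx
        by_cases hxa : x = a
        · exact Or.inl hxa
        · obtain ⟨y, rfl⟩ := exists_bump_eq hxa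
          refine Or.inr ⟨y, (h y).2 ?_, rfl⟩
          unfold bump at hx
          split_ifs at hx <;> omega
  rw [IsStandardWord, hlen, hlab, hnodup, hmem]
  simp only [prepend, IsForestWord, isForestWord_mapLabels (bump_strictMono a), hpw, hall,
    queueLength_mapLabels, IsStandardWord, headChoices, mem_leafLabels, Finset.mem_filter,
    Finset.mem_product, Finset.mem_range]
  constructor
  · rintro ⟨⟨hw, hp, hk, hq, hk2⟩, hn, ha, hm⟩
    refine ⟨⟨hw, hn, hm⟩, ⟨⟨ha, hp⟩, by omega⟩, hq, fun hk0 => ?_⟩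
    rcases w with _ | ⟨p, w⟩
    · exact absurd (Nat.le_zero.1 hq) hk0
    · have := hk hk0 1 ((hm 1).2 (by simp))
      omega
  · rintro ⟨⟨hw, hn, hm⟩, ⟨⟨ha, hp⟩, hk2⟩, hq, hk⟩
    refine ⟨⟨hw, hp, fun hk0 x hx => ?_, hq, by omega⟩, hn, ha, hm⟩
    rw [hk hk0]
    exact ((hm x).1 hx).1

/-- The standard words of length `N`. -/
def standardWords : ℕ → Finset (List (ℕ × ℕ))
  | 0 => {[]}
  | N + 1 => ((standardWords N).sigma headChoices).image fun p => prepend p.2.1 p.2.2 p.1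

theorem mem_standardWords {N : ℕ} {w : List (ℕ × ℕ)} :
    w ∈ standardWords N ↔ w.length = N ∧ IsStandardWord w := by
  induction N generalizing w with
  | zero =>
    simp only [standardWords, Finset.mem_singleton, List.length_eq_zero_iff]
    refine ⟨?_, fun h => h.1⟩
    rintro rfl
    refine ⟨rfl, trivial, List.nodup_nil, fun x => ?_⟩
    simp only [List.map_nil, List.not_mem_nil, List.length_nil, false_iff]
    omega
  | succ N ih =>
    simp only [standardWords, Finset.mem_image, Finset.mem_sigma, ih]
    constructor
    · rintro ⟨⟨w, a, k⟩, ⟨⟨hl, hw⟩, hc⟩, rfl⟩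
      exact ⟨by simp [prepend, mapLabels, hl], (isStandardWord_prepend_iff a k w).2 ⟨hw, hc⟩⟩
    · rintro ⟨hl, hw⟩
      rcases w with _ | ⟨⟨a, k⟩, v⟩
      · simp at hl
      · obtain ⟨w, hv⟩ := exists_eq_prepend hw.2.1
        rw [← hv] at hl hw ⊢
        rw [isStandardWord_prepend_iff] at hw
        exact ⟨⟨w, a, k⟩, ⟨⟨by simpa [prepend, mapLabels] using hl, hw.1⟩, hw.2⟩, rfl⟩

theorem leafLabels_prepend {a k : ℕ} {w : List (ℕ × ℕ)} (hw : IsStandardWord w)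
    (ha : a ∈ leafLabels w) : leafLabels (prepend a k w) =
      insert (w.length + 2) ((leafLabels w).filter (· ≤ a)) := by
  have hm := hw.2.2
  rw [mem_leafLabels] at ha
  ext c
  simp only [mem_leafLabels, prepend, mapLabels, List.length_cons, List.length_map,
    List.pairwise_cons, List.pairwise_map, List.mem_map, Finset.mem_insert, Finset.mem_filter,
    Prod.map_fst]
  constructor
  · rintro ⟨hc, h1, h2⟩
    by_cases hcN : c = w.length + 2
    · exact Or.inl hcN
    have hca : c ≤ a := by
      by_contra! hca
      obtain ⟨p, hp, hpN⟩ := List.mem_map.1 ((hm w.length).2 (by omega))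
      refine h1 _ ⟨p, hp, rfl⟩ ⟨hca, ?_⟩
      rw [Prod.map_fst, hpN]
      unfold bump
      split_ifs <;> omega
    refine Or.inr ⟨⟨by omega, h2.imp fun {x y} h => ?_⟩, hca⟩
    unfold bump at h
    split_ifs at h <;> omega
  · rintro (rfl | ⟨⟨hc, hp⟩, hca⟩)
    · have hlt : ∀ y ∈ w, bump a y.1 < w.length + 2 := by
        intro y hy
        have := (hm y.1).1 (List.mem_map_of_mem hy)
        unfold bump
        split_ifs <;> omega
      refine ⟨by omega, ?_, List.pairwise_of_forall_mem_list fun x _ y hy h => ?_⟩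
      · rintro _ ⟨y, hy, rfl⟩ ⟨-, h⟩
        exact absurd (hlt y hy) (not_lt.2 h)
      · exact absurd (hlt y hy) (not_lt.2 h.2)
    · refine ⟨by omega, fun y _ h => by omega, hp.imp fun {x y} h => ?_⟩
      unfold bump
      split_ifs <;> omega

theorem card_leafLabels_prepend {a k : ℕ} {w : List (ℕ × ℕ)} (hw : IsStandardWord w)
    (ha : a ∈ leafLabels w) : (leafLabels (prepend a k w)).card =
      ((leafLabels w).filter (· ≤ a)).card + 1 := by
  rw [leafLabels_prepend hw ha, Finset.card_insert_of_notMem]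
  simp only [mem_leafLabels, Finset.mem_filter]
  omega

theorem one_mem_leafLabels {w : List (ℕ × ℕ)} (hw : IsStandardWord w) : 1 ∈ leafLabels w := by
  rw [mem_leafLabels]
  refine ⟨by omega, List.pairwise_of_forall_mem_list fun x hx y _ h => ?_⟩
  have := (hw.2.2 x.1).1 (List.mem_map_of_mem hx)
  omega

theorem card_leafLabels_filter_le_one {w : List (ℕ × ℕ)} (hw : IsStandardWord w) :
    ((leafLabels w).filter (· ≤ 1)).card = 1 := by
  rw [Finset.card_eq_one]
  refine ⟨1, ?_⟩
  ext c
  have h1 := one_mem_leafLabels hw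
  simp only [mem_leafLabels, Finset.mem_filter, Finset.mem_singleton] at h1 ⊢
  constructor
  · omega
  · rintro rfl
    exact ⟨h1, le_rfl⟩

theorem sum_card_filter_le (S : Finset ℕ) (f : ℕ → ℕ) :
    ∑ a ∈ S, f (S.filter (· ≤ a)).card = ∑ i ∈ Finset.range S.card, f (i + 1) := by
  induction S using Finset.induction_on_max with
  | empty => simp
  | insert a S hlt ih =>
    have ha : a ∉ S := fun h => lt_irrefl _ (hlt a h)
    rw [Finset.sum_insert ha, Finset.card_insert_of_notMem ha, Finset.sum_range_succ, ← ih,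
      add_comm]
    congr 1
    · refine Finset.sum_congr rfl fun x hx => ?_
      rw [Finset.filter_insert, if_neg (not_le.2 (hlt x hx))]
    · rw [Finset.filter_true_of_mem, Finset.card_insert_of_notMem ha]
      intro x hx
      rcases Finset.mem_insert.1 hx with rfl | hx
      · exact le_rfl
      · exact (hlt x hx).le

/-- Number of unary vertices of a word. -/
def wordUnaryCount (w : List (ℕ × ℕ)) : ℕ := (w.map Prod.snd).count 1

theorem wordUnaryCount_cons (p : ℕ × ℕ) (w : List (ℕ × ℕ)) :
    wordUnaryCount (p :: w) = wordUnaryCount w + if p.2 = 1 then 1 else 0 := by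
  simp [wordUnaryCount, List.count_cons]

theorem wordUnaryCount_mapLabels (f : ℕ → ℕ) (w : List (ℕ × ℕ)) :
    wordUnaryCount (mapLabels f w) = wordUnaryCount w := by
  simp [wordUnaryCount, mapLabels, Function.comp_def]

theorem sum_headChoices {w : List (ℕ × ℕ)} (hw : IsStandardWord w) (U r : ℕ) :
    ∑ p ∈ headChoices w, completions U r (leafLabels (prepend p.1 p.2 w)).card
        (queueLength (prepend p.1 p.2 w)) (wordUnaryCount (prepend p.1 p.2 w)) =
      completions U (r + 1) (leafLabels w).card (queueLength w) (wordUnaryCount w) := by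
  have h1 := one_mem_leafLabels hw
  have key : ∀ p ∈ headChoices w, completions U r (leafLabels (prepend p.1 p.2 w)).card
        (queueLength (prepend p.1 p.2 w)) (wordUnaryCount (prepend p.1 p.2 w)) =
      completions U r (((leafLabels w).filter (· ≤ p.1)).card + 1) (queueLength w + 1 - p.2)
        (wordUnaryCount w + if p.2 = 1 then 1 else 0) := by
    rintro ⟨a, k⟩ hp
    simp only [headChoices, Finset.mem_filter, Finset.mem_product] at hp
    rw [card_leafLabels_prepend hw hp.1.1]
    simp only [prepend, queueLength, queueLength_mapLabels, wordUnaryCount_cons,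
      wordUnaryCount_mapLabels]
  rw [Finset.sum_congr rfl key, headChoices, Finset.sum_filter, Finset.sum_product_right]
  have split : ∀ k, k ≠ 0 → ∑ a ∈ leafLabels w, (if k ≤ queueLength w ∧ (k ≠ 0 → a = 1) then
      completions U r (((leafLabels w).filter (· ≤ a)).card + 1) (queueLength w + 1 - k)
        (wordUnaryCount w + if k = 1 then 1 else 0) else 0) =
      if k ≤ queueLength w then completions U r 2 (queueLength w + 1 - k)
        (wordUnaryCount w + if k = 1 then 1 else 0) else 0 := by
    intro k hk
    rw [Finset.sum_eq_single_of_mem 1 h1]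
    · simp [card_leafLabels_filter_le_one hw]
    · intro a _ ha
      rw [if_neg]
      tauto
  rw [Finset.sum_range_succ, Finset.sum_range_succ, Finset.sum_range_one, completions,
    split 1 one_ne_zero, split 2 two_ne_zero,
    ← sum_card_filter_le (leafLabels w) fun m => completions U r (m + 1) _ _]
  simp

theorem prepend_injective {w w' : List (ℕ × ℕ)} {a k a' k' : ℕ}
    (h : prepend a k w = prepend a' k' w') : a = a' ∧ k = k' ∧ w = w' := by
  simp only [prepend, List.cons.injEq, Prod.mk.injEq] at h
  obtain ⟨⟨rfl, rfl⟩, h⟩ := h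
  exact ⟨rfl, rfl, mapLabels_bump_injective a h⟩

theorem sum_standardWords_completions (U : ℕ) : ∀ r N,
    ∑ w ∈ standardWords N, completions U r (leafLabels w).card (queueLength w)
        (wordUnaryCount w) =
      ((standardWords (N + r)).filter fun w => queueLength w = 1 ∧ wordUnaryCount w = U).card := by
  intro r
  induction r with
  | zero =>
    intro N
    rw [Finset.card_filter]
    rfl
  | succ r ih =>
    intro N
    rw [show N + (r + 1) = N + 1 + r by omega, ← ih (N + 1), standardWords, Finset.sum_image,
      Finset.sum_sigma]
    · exact Finset.sum_congr rfl fun w hw => (sum_headChoices (mem_standardWords.1 hw).2 U r).symm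
    · rintro ⟨w, a, k⟩ - ⟨w', a', k'⟩ - h
      obtain ⟨rfl, rfl, rfl⟩ := prepend_injective h
      rfl

theorem card_standardWords (U n : ℕ) :
    ((standardWords n).filter fun w => queueLength w = 1 ∧ wordUnaryCount w = U).card =
      completions U n 1 0 0 := by
  rw [← Nat.zero_add n, ← sum_standardWords_completions U n 0]
  simp [standardWords, leafLabels, queueLength, wordUnaryCount]

theorem avoids213_cons (a : ℕ) (l : List ℕ) :
    Avoids213 (a :: l) ↔ l.Pairwise (fun x y => ¬(x < a ∧ a < y)) ∧ Avoids213 l := by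
  constructor
  · intro h
    refine ⟨List.pairwise_iff_getElem.2 fun i j hi hj hij hlt => ?_, fun i j k hij hjk hk => ?_⟩
    · refine h 0 (i + 1) (j + 1) (by omega) (by omega) (by simpa using hj) ?_
      simpa [hi, hj] using hlt
    · exact h (i + 1) (j + 1) (k + 1) (by omega) (by omega) (by simpa using hk)
  · rintro ⟨hp, h⟩ i j k hij hjk hk
    obtain ⟨j, rfl⟩ : ∃ j', j = j' + 1 := ⟨j - 1, by omega⟩
    obtain ⟨k, rfl⟩ : ∃ k', k = k' + 1 := ⟨k - 1, by omega⟩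
    have hk' : k < l.length := by simpa using hk
    rcases i with _ | i
    · have := List.pairwise_iff_getElem.1 hp j k (by omega) hk' (by omega)
      simpa [hk', show j < l.length by omega] using this
    · exact h i j k (by omega) (by omega) hk'

theorem UBTree.increasing_iff (t : UBTree) :
    t.increasing ↔ ∀ c ∈ t.children, t.label < c.label ∧ c.increasing := by
  cases t <;> simp [UBTree.increasing, UBTree.children, UBTree.label]
  tauto

theorem UBTree.length_children_le (t : UBTree) : t.children.length ≤ 2 := by
  cases t <;> simp [UBTree.children]

theorem UBTree.size_eq (t : UBTree) : t.size = 1 + (t.children.map UBTree.size).sum := by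
  cases t <;> simp [UBTree.size, UBTree.children, Nat.add_assoc]

theorem UBTree.unaryCount_eq (t : UBTree) : t.unaryCount =
    (t.children.map UBTree.unaryCount).sum + if t.children.length = 1 then 1 else 0 := by
  cases t <;> simp [UBTree.unaryCount, UBTree.children, Nat.add_comm]

theorem UBTree.ext_of_label_of_children {t t' : UBTree} (hl : t.label = t'.label)
    (hc : t.children = t'.children) : t = t' := by
  cases t <;> cases t' <;> simp_all [UBTree.label, UBTree.children]

theorem UBTree.exists_of_children (a : ℕ) {ts : List UBTree} (h : ts.length ≤ 2) :
    ∃ t : UBTree, t.label = a ∧ t.children = ts := by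
  match ts, h with
  | [], _ => exact ⟨.lf a, rfl, rfl⟩
  | [c], _ => exact ⟨.un a c, rfl, rfl⟩
  | [c, d], _ => exact ⟨.bin a c d, rfl, rfl⟩

/-- Number of vertices of a forest. -/
def forestSize (ts : List UBTree) : ℕ := (ts.map UBTree.size).sum

theorem forestSize_cons (t : UBTree) (ts : List UBTree) :
    forestSize (t :: ts) = forestSize (ts ++ t.children) + 1 := by
  simp [forestSize, t.size_eq]
  omega

/-- The word of pairs (label, arity) read in breadth-first order from a queue of trees. -/
def forestWord : ℕ → List UBTree → List (ℕ × ℕ)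
  | 0, _ => []
  | _ + 1, [] => []
  | n + 1, t :: ts => (t.label, t.children.length) :: forestWord n (ts ++ t.children)

/-- Induction along the breadth-first traversal of a forest. -/
theorem bfs_induction {motive : ℕ → List UBTree → Prop} (nil : motive 0 [])
    (cons : ∀ n t ts, forestSize (ts ++ t.children) = n → motive n (ts ++ t.children) →
      motive (n + 1) (t :: ts)) : ∀ n ts, forestSize ts = n → motive n ts := by
  intro n
  induction n with
  | zero =>
    intro ts h
    rcases ts with _ | ⟨t, ts⟩
    · exact nil
    · simp [forestSize_cons] at h
  | succ n ih =>
    intro ts h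
    rcases ts with _ | ⟨t, ts⟩
    · simp [forestSize] at h
    · rw [forestSize_cons, Nat.add_right_cancel_iff] at h
      exact cons n t ts h (ih _ h)

theorem map_fst_forestWord (n : ℕ) (ts : List UBTree) :
    (forestWord n ts).map Prod.fst = bfsAux UBTree.label n ts := by
  fun_induction forestWord n ts <;> simp_all [bfsAux]

theorem length_forestWord : ∀ n ts, forestSize ts = n → (forestWord n ts).length = n :=
  bfs_induction rfl fun n t ts _ ih => by simp [forestWord, ih]

theorem queueLength_forestWord :
    ∀ n ts, forestSize ts = n → queueLength (forestWord n ts) = ts.length :=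
  bfs_induction rfl fun n t ts _ ih => by
    simp only [forestWord, queueLength, ih, List.length_append, List.length_cons]
    omega

theorem wordUnaryCount_forestWord : ∀ n ts, forestSize ts = n →
    wordUnaryCount (forestWord n ts) = (ts.map UBTree.unaryCount).sum :=
  bfs_induction rfl fun n t ts _ ih => by
    rw [forestWord, wordUnaryCount_cons, ih, List.map_append, List.sum_append, List.map_cons,
      List.sum_cons, t.unaryCount_eq]
    ring

theorem label_mem_forestWord : ∀ n ts, forestSize ts = n →
    ∀ t ∈ ts, t.label ∈ (forestWord n ts).map Prod.fst :=
  bfs_induction (by simp) fun n t ts _ ih s hs => by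
    rw [forestWord, List.map_cons, List.mem_cons]
    rcases List.mem_cons.1 hs with rfl | hs
    · exact Or.inl rfl
    · exact Or.inr (ih s (List.mem_append_left _ hs))

/-- If the last root of an increasing forest has a label above `v` and the labels above `v`
precede the labels below `v`, then all labels are above `v`. -/
theorem lt_of_mem_forestWord (v : ℕ) : ∀ n ts, forestSize ts = n →
    (∀ t ∈ ts, t.increasing) → (∀ t ∈ ts.getLast?, v < t.label) →
    (forestWord n ts).Pairwise (fun x y => ¬(x.1 < v ∧ v < y.1)) →
    v ∉ (forestWord n ts).map Prod.fst → ∀ p ∈ forestWord n ts, v < p.1 :=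
  bfs_induction (by simp [forestWord]) fun n t ts hn ih hinc hlast hp hv => by
    rw [forestWord] at hp hv ⊢
    rw [List.pairwise_cons] at hp
    rw [List.map_cons, List.mem_cons, not_or] at hv
    have ht : v < t.label := by
      rcases List.eq_nil_or_concat ts with rfl | ⟨ts, c, rfl⟩
      · exact hlast t rfl
      · have hc := hlast c (by simp [List.getLast?_cons])
        have hmem := label_mem_forestWord _ _ hn c (by simp)
        obtain ⟨p, hpm, hpc⟩ := List.mem_map.1 hmem
        have := hp.1 p hpm
        simp only [hpc] at this
        omega
    have hchildren := t.increasing_iff.1 (hinc t List.mem_cons_self)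
    rw [List.forall_mem_cons]
    refine ⟨ht, ih ?_ ?_ hp.2 hv.2⟩
    · intro s hs
      rcases List.mem_append.1 hs with hs | hs
      · exact hinc s (List.mem_cons_of_mem _ hs)
      · exact (hchildren s hs).2
    · intro s hs
      rw [List.getLast?_append] at hs
      cases hc : t.children.getLast? with
      | none =>
        rw [hc, Option.none_or] at hs
        refine hlast s ?_
        rw [List.getLast?_cons, Option.mem_def.1 hs]
        rfl
      | some c =>
        rw [hc, Option.some_or] at hs
        obtain rfl : c = s := by simpa using hs
        exact ht.trans (hchildren c (List.mem_of_getLast? hc)).1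

theorem isForestWord_forestWord_iff : ∀ n ts, forestSize ts = n →
    ((forestWord n ts).map Prod.fst).Nodup →
    (IsForestWord (forestWord n ts) ↔
      (∀ t ∈ ts, t.increasing) ∧ Avoids213 ((forestWord n ts).map Prod.fst)) :=
  bfs_induction
    (fun _ => by simp [forestWord, IsForestWord, Avoids213])
    fun n t ts hn ih hnodup => by
      rw [forestWord, List.map_cons] at hnodup ⊢
      rw [List.nodup_cons] at hnodup
      rw [IsForestWord, avoids213_cons, ih hnodup.2, queueLength_forestWord n _ hn,
        List.pairwise_map, List.forall_mem_cons, List.forall_mem_append]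
      constructor
      · rintro ⟨⟨⟨hts, hch⟩, hav⟩, hp, hmin, -⟩
        refine ⟨⟨t.increasing_iff.2 fun c hc => ⟨?_, hch c hc⟩, hts⟩, hp, hav⟩
        obtain ⟨p, hpm, hpc⟩ := List.mem_map.1
          (label_mem_forestWord _ _ hn c (List.mem_append_right _ hc))
        rw [← hpc]
        exact hmin (List.length_pos_of_mem hc).ne' p hpm
      · rintro ⟨⟨ht, hts⟩, hp, hav⟩
        have hch := t.increasing_iff.1 ht
        refine ⟨⟨⟨hts, fun c hc => (hch c hc).2⟩, hav⟩, hp, fun hk => ?_, by simp,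
          t.length_children_le⟩
        refine lt_of_mem_forestWord t.label n _ hn ?_ ?_ hp hnodup.1
        · rw [List.forall_mem_append]
          exact ⟨hts, fun c hc => (hch c hc).2⟩
        · intro c hc
          have hne : t.children ≠ [] := fun h => hk (by rw [h]; rfl)
          rw [List.getLast?_append, List.getLast?_eq_some_getLast hne, Option.some_or,
            Option.mem_some_iff] at hc
          exact (hch c (hc ▸ List.getLast_mem hne)).1

theorem forestWord_injective : ∀ n ts, forestSize ts = n → ∀ ts', forestSize ts' = n →
    forestWord n ts = forestWord n ts' → ts = ts' :=
  bfs_induction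
    (fun ts' h _ => by
      rcases ts' with _ | ⟨t, ts⟩
      · rfl
      · simp [forestSize_cons] at h)
    fun n t ts _ ih ts' h hw => by
      rcases ts' with _ | ⟨t', ts'⟩
      · simp [forestSize] at h
      · rw [forestSize_cons, Nat.add_right_cancel_iff] at h
        simp only [forestWord, List.cons.injEq, Prod.mk.injEq] at hw
        obtain ⟨rfl, hc⟩ := List.append_inj' (ih _ h hw.2) hw.1.2
        rw [UBTree.ext_of_label_of_children hw.1.1 hc]

theorem exists_forestWord_eq {w : List (ℕ × ℕ)} (hw : IsForestWord w) :
    ∃ ts, forestSize ts = w.length ∧ forestWord w.length ts = w := by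
  induction w with
  | nil => exact ⟨[], rfl, rfl⟩
  | cons p w ih =>
    obtain ⟨a, k⟩ := p
    obtain ⟨hw, -, -, hk, hk2⟩ := hw
    obtain ⟨ts, hs, hts⟩ := ih hw
    have hlen := queueLength_forestWord _ ts hs
    rw [hts] at hlen
    have hk' : (ts.drop (ts.length - k)).length = k := by
      rw [List.length_drop]
      omega
    obtain ⟨t, rfl, hch⟩ := UBTree.exists_of_children a (hk'.trans_le hk2)
    have happ : ts.take (ts.length - k) ++ t.children = ts := by
      rw [hch, List.take_append_drop]
    refine ⟨t :: ts.take (ts.length - k), ?_, ?_⟩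
    · rw [forestSize_cons, happ, hs, List.length_cons]
    · rw [List.length_cons, forestWord, happ, hts, hch, hk']

theorem UBTree.forestSize_singleton (t : UBTree) : forestSize [t] = t.size := by
  simp [forestSize]

theorem isStandardWord_forestWord_iff (t : UBTree) :
    IsStandardWord (forestWord t.size [t]) ↔ IsGoodUB t := by
  have hlen := length_forestWord t.size [t] t.forestSize_singleton
  have hperm : t.bfs.Perm (List.range' 1 t.size) ↔
      t.bfs.Nodup ∧ ∀ x, x ∈ t.bfs ↔ 1 ≤ x ∧ x ≤ t.size := by
    have hmem : ∀ x, x ∈ List.range' 1 t.size ↔ 1 ≤ x ∧ x ≤ t.size := by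
      intro x
      rw [List.mem_range'_1]
      omega
    constructor
    · intro h
      exact ⟨h.nodup_iff.2 List.nodup_range', fun x => h.mem_iff.trans (hmem x)⟩
    · rintro ⟨hn, h⟩
      exact (List.perm_ext_iff_of_nodup hn List.nodup_range').2 fun x => (h x).trans (hmem x).symm
  have hfst : (forestWord t.size [t]).map Prod.fst = t.bfs := map_fst_forestWord _ _
  rw [IsStandardWord, IsGoodUB, hperm, hfst, hlen]
  have h := isForestWord_forestWord_iff t.size [t] t.forestSize_singleton
  rw [hfst, List.forall_mem_singleton] at h
  constructor
  · rintro ⟨hw, hn, hm⟩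
    exact ⟨((h hn).1 hw).1, ⟨hn, hm⟩, ((h hn).1 hw).2⟩
  · rintro ⟨hi, ⟨hn, hm⟩, ha⟩
    exact ⟨(h hn).2 ⟨hi, ha⟩, hn, hm⟩

theorem card_goodTrees (n U : ℕ) :
    Nat.card {t : UBTree // t.size = n ∧ IsGoodUB t ∧ t.unaryCount = U} =
      ((standardWords n).filter fun w => queueLength w = 1 ∧ wordUnaryCount w = U).card := by
  rw [← Nat.card_eq_finsetCard]
  have hmem : ∀ t : UBTree, t.size = n ∧ IsGoodUB t ∧ t.unaryCount = U →
      forestWord n [t] ∈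
        (standardWords n).filter fun w => queueLength w = 1 ∧ wordUnaryCount w = U := by
    rintro t ⟨rfl, hg, rfl⟩
    have hs := t.forestSize_singleton
    rw [Finset.mem_filter, mem_standardWords, isStandardWord_forestWord_iff,
      length_forestWord _ _ hs, queueLength_forestWord _ _ hs, wordUnaryCount_forestWord _ _ hs]
    simpa using hg
  refine Nat.card_eq_of_bijective (fun t => ⟨forestWord n [t.1], hmem t.1 t.2⟩) ⟨?_, ?_⟩
  · rintro ⟨t, ht⟩ ⟨t', ht'⟩ h
    have := forestWord_injective n [t] (t.forestSize_singleton.trans ht.1) [t']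
      (t'.forestSize_singleton.trans ht'.1) (congrArg Subtype.val h)
    exact Subtype.ext (List.singleton_inj.1 this)
  · rintro ⟨w, hw⟩
    obtain ⟨hwn, hq, hU⟩ := Finset.mem_filter.1 hw
    obtain ⟨rfl, hstd⟩ := mem_standardWords.1 hwn
    obtain ⟨ts, hs, hts⟩ := exists_forestWord_eq hstd.1
    have hlen := queueLength_forestWord _ ts hs
    rw [hts, hq] at hlen
    obtain ⟨t, rfl⟩ := List.length_eq_one_iff.1 hlen.symm
    have hcount := wordUnaryCount_forestWord _ _ hs
    rw [t.forestSize_singleton] at hs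
    refine ⟨⟨t, hs, ?_, ?_⟩, Subtype.ext hts⟩
    · rw [← isStandardWord_forestWord_iff, hs, hts]
      exact hstd
    · rw [hts, hU] at hcount
      simpa using hcount.symm

/-- Refined count of increasing unary-binary trees with associated permutation
avoiding 213, by number of unary nodes. -/
theorem stmt5 (n k : ℕ) (hn : 1 ≤ n) (hk : k ≤ (n - 1) / 2) :
    n * Nat.card {t : UBTree //
        t.size = n ∧ IsGoodUB t ∧ t.unaryCount = n - 1 - 2 * k} =
      Nat.choose (2 * n) k * Nat.choose (n - k) (k + 1) := by
  rw [card_goodTrees, card_standardWords, mul_completions n k hn hk]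
end

section
/- For every integer n ≥ 1, the number of basketball walks of length n from 0 to 1 that are positive except at the origin is equal to (1/n)·∑_{k ≥ 0} binomial(2n, k)·binomial(n-k, k+1). -/
/-- Height of a walk (given by its list of steps) after `i` steps. -/
def ht (s : List ℤ) (i : ℕ) : ℤ := (s.take i).sum

/-- A basketball walk: every step lies in `{-2, -1, 1, 2}`. -/
def IsBasketball (s : List ℤ) : Prop := ∀ x ∈ s, x = -2 ∨ x = -1 ∨ x = 1 ∨ x = 2

/-- A C-walk: a basketball walk from 0 to 0 that visits 1 and is positive
except at its extremities. -/
def IsCWalk (s : List ℤ) : Prop :=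
  IsBasketball s ∧ ht s s.length = 0 ∧
    (∀ i, 0 < i → i < s.length → 0 < ht s i) ∧ ∃ i, i ≤ s.length ∧ ht s i = 1

/-- A G-walk: a basketball walk from 0 to 1 that is positive except at the origin. -/
def IsGWalk (s : List ℤ) : Prop :=
  IsBasketball s ∧ ht s s.length = 1 ∧ ∀ i, 1 ≤ i → i ≤ s.length → 0 < ht s i

/-- An A-walk (basketball excursion): a nonnegative basketball walk from 0 to 0. -/
def IsAWalk (s : List ℤ) : Prop :=
  IsBasketball s ∧ ht s s.length = 0 ∧ ∀ i, i ≤ s.length → 0 ≤ ht s i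

/-- A B-walk: a basketball walk from 0 to 1 that visits 0 and 1 only at its extremities. -/
def IsBWalk (s : List ℤ) : Prop :=
  IsBasketball s ∧ ht s s.length = 1 ∧
    ∀ i, 0 < i → i < s.length → ht s i ≠ 0 ∧ ht s i ≠ 1

/-- Number of `±1`-steps of a walk. -/
noncomputable def pmOneSteps (s : List ℤ) : ℕ :=
  Set.ncard {i : ℕ | i < s.length ∧ (s.getD i 0 = 1 ∨ s.getD i 0 = -1)}

/-- Number of steps that are odd `+2`-steps or even `-2`-steps
(the step of index `i`, 0-based, starts at height `ht s i`). -/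
noncomputable def lSteps (s : List ℤ) : ℕ :=
  Set.ncard {i : ℕ | i < s.length ∧
    ((s.getD i 0 = 2 ∧ Odd (ht s i)) ∨ (s.getD i 0 = -2 ∧ Even (ht s i)))}

/-- Number of steps that are odd `-2`-steps or even `+2`-steps. -/
noncomputable def rSteps (s : List ℤ) : ℕ :=
  Set.ncard {i : ℕ | i < s.length ∧
    ((s.getD i 0 = -2 ∧ Odd (ht s i)) ∨ (s.getD i 0 = 2 ∧ Even (ht s i)))}

/-- The (0-based) steps of indices `i < j` are paired: the `i`-th step is a `+2`,
the `j`-th step is a `-2`, the walk after step `j` is back at the height it had before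
step `i`, and strictly in between the walk stays at least one above that height. -/
def Paired (s : List ℤ) (i j : ℕ) : Prop :=
  i < j ∧ j < s.length ∧ s.getD i 0 = 2 ∧ s.getD j 0 = -2 ∧
    ht s (j + 1) = ht s i ∧ ∀ k, i + 1 < k → k ≤ j → ht s i + 1 ≤ ht s k

/-- A staggered `±2`-step: a `±2`-step that is not paired with any other `±2`-step. -/
def IsStaggered (s : List ℤ) (i : ℕ) : Prop :=
  i < s.length ∧ (s.getD i 0 = 2 ∨ s.getD i 0 = -2) ∧
    (∀ j, ¬ Paired s i j) ∧ ∀ j, ¬ Paired s j i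

/-- Number of staggered `±2`-steps of a walk. -/
noncomputable def staggeredCount (s : List ℤ) : ℕ :=
  Set.ncard {i : ℕ | IsStaggered s i}

open PowerSeries in
/-- The Lagrange kernel `(1 + X + X²)² / (1 + X)` of the generating function of G-walks. -/
noncomputable def lagrangeKernel : ℚ⟦X⟧ := (1 + X + X ^ 2) ^ 2 * (1 + X)⁻¹

open PowerSeries in
/-- The `n`-th coefficient of `F ∘ g`, where `g = X * (lagrangeKernel ∘ g)`, written in
Lagrange's form. -/
noncomputable def lagrangeCoeff (n : ℕ) (F : ℚ⟦X⟧) : ℚ :=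
  coeff n (F * lagrangeKernel ^ n *
    (1 - X * derivative ℚ lagrangeKernel * lagrangeKernel⁻¹))

open PowerSeries in
/-- The complete homogeneous symmetric functions (shifted by one) of the two small roots of the
kernel equation of basketball walks, as series in `g = X`. -/
noncomputable def heightSeries : ℕ → ℚ⟦X⟧
  | 0 => 0
  | 1 => 1
  | j + 2 => X * heightSeries (j + 1) + X * (1 + X)⁻¹ * heightSeries j

/-- The walks of length `n` that end at `h` and are positive except at the origin. -/
def positiveWalks : ℕ → ℤ → Finset (List ℤ)
  | 0, h => if h = 0 then {[]} else ∅
  | n + 1, h =>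
    if 0 < h then
      ({-2, -1, 1, 2} : Finset ℤ).biUnion
        fun d => (positiveWalks n (h - d)).image fun s => s ++ [d]
    else ∅

section PowerSeriesLemmas

open PowerSeries

lemma one_add_X_mul_inv : (1 + X : ℚ⟦X⟧) * (1 + X)⁻¹ = 1 :=
  PowerSeries.mul_inv_cancel _ (by simp)

lemma constantCoeff_lagrangeKernel : constantCoeff lagrangeKernel = 1 := by
  simp [lagrangeKernel]

lemma lagrangeKernel_mul_inv : lagrangeKernel * lagrangeKernel⁻¹ = 1 :=
  PowerSeries.mul_inv_cancel _ (by simp [constantCoeff_lagrangeKernel])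

lemma lagrangeCoeff_add (n : ℕ) (F G : ℚ⟦X⟧) :
    lagrangeCoeff n (F + G) = lagrangeCoeff n F + lagrangeCoeff n G := by
  simp [lagrangeCoeff, add_mul]

lemma lagrangeCoeff_zero_left (F : ℚ⟦X⟧) : lagrangeCoeff 0 F = constantCoeff F := by
  simp [lagrangeCoeff]

lemma lagrangeCoeff_zero_right (n : ℕ) : lagrangeCoeff n 0 = 0 := by
  simp [lagrangeCoeff]

lemma lagrangeCoeff_succ_X_mul_inv_mul (n : ℕ) (F : ℚ⟦X⟧) :
    lagrangeCoeff (n + 1) (X * lagrangeKernel⁻¹ * F) = lagrangeCoeff n F := by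
  unfold lagrangeCoeff
  rw [← coeff_succ_X_mul n]
  congr 1
  linear_combination
    (X * F * lagrangeKernel ^ n * (1 - X * derivative ℚ lagrangeKernel * lagrangeKernel⁻¹)) *
      lagrangeKernel_mul_inv

lemma derivative_lagrangeKernel_pow_succ (m : ℕ) :
    derivative ℚ (lagrangeKernel ^ (m + 1)) =
      C (m + 1 : ℚ) * (lagrangeKernel ^ m * derivative ℚ lagrangeKernel) := by
  rw [Derivation.leibniz_pow]
  simp

lemma lagrangeCoeff_succ_eq (m : ℕ) (F : ℚ⟦X⟧) :
    lagrangeCoeff (m + 1) F = coeff (m + 1) (F * lagrangeKernel ^ (m + 1)) -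
      coeff (m + 1) (X * (F * (lagrangeKernel ^ m * derivative ℚ lagrangeKernel))) := by
  unfold lagrangeCoeff
  rw [← map_sub]
  congr 1
  linear_combination
    (-X * F * lagrangeKernel ^ m * derivative ℚ lagrangeKernel) * lagrangeKernel_mul_inv

lemma lagrangeCoeff_succ_one (m : ℕ) : lagrangeCoeff (m + 1) 1 = 0 := by
  have h := congrArg (coeff m) (derivative_lagrangeKernel_pow_succ m)
  rw [coeff_derivative, coeff_C_mul] at h
  have hm : (m + 1 : ℚ) ≠ 0 := by positivity
  rw [lagrangeCoeff_succ_eq, coeff_succ_X_mul, one_mul, one_mul]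
  apply mul_left_cancel₀ hm
  linear_combination h

lemma succ_mul_lagrangeCoeff_succ_X (m : ℕ) :
    (m + 1 : ℚ) * lagrangeCoeff (m + 1) X = coeff m (lagrangeKernel ^ (m + 1)) := by
  rw [lagrangeCoeff_succ_eq, coeff_succ_X_mul, coeff_succ_X_mul]
  cases m with
  | zero => simp
  | succ m =>
    have h := congrArg (coeff m) (derivative_lagrangeKernel_pow_succ (m + 1))
    rw [coeff_derivative, coeff_C_mul] at h
    rw [coeff_succ_X_mul]
    push_cast at h ⊢
    linear_combination h

lemma X_mul_lagrangeKernel_inv_mul :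
    X * lagrangeKernel⁻¹ * (1 + X + X ^ 2) ^ 2 = X * (1 + X : ℚ⟦X⟧) := by
  have h : lagrangeKernel * (1 + X) = (1 + X + X ^ 2) ^ 2 := by
    rw [lagrangeKernel]
    linear_combination (1 + X + X ^ 2) ^ 2 * one_add_X_mul_inv
  rw [← h]
  linear_combination X * (1 + X) * lagrangeKernel_mul_inv

lemma heightSeries_kernel_equation (j : ℕ) :
    heightSeries (j + 2) = X * lagrangeKernel⁻¹ *
      (heightSeries j + heightSeries (j + 1) + heightSeries (j + 3) + heightSeries (j + 4)) := by
  simp only [heightSeries]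
  generalize heightSeries j = x
  generalize heightSeries (j + 1) = y
  have h₁ := one_add_X_mul_inv
  have h₂ := X_mul_lagrangeKernel_inv_mul
  generalize X * lagrangeKernel⁻¹ = f at h₂ ⊢
  generalize (1 + X : ℚ⟦X⟧)⁻¹ = b at h₁ ⊢
  have hX : (1 + X : ℚ⟦X⟧) ≠ 0 := left_ne_zero_of_mul_eq_one h₁
  apply mul_left_cancel₀ (mul_ne_zero X_ne_zero hX)
  linear_combination (-(X * y + X * b * x)) * h₂ -
    f * ((X * y + X * b * x) * X ^ 2 + X ^ 2 * (1 + X) * y - X * (1 + X) * x) * h₁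

lemma constantCoeff_heightSeries (j : ℕ) :
    constantCoeff (heightSeries (j + 2)) = 0 := by
  simp [heightSeries]

lemma coeff_lagrangeKernel_pow (m : ℕ) :
    coeff m (lagrangeKernel ^ (m + 1)) =
      ∑ k ∈ Finset.range (m + 1 + 1),
        ((2 * (m + 1)).choose k * (m + 1 - k).choose (k + 1) : ℚ) := by
  have h : lagrangeKernel ^ (m + 1) = ∑ k ∈ Finset.range (2 * (m + 1) + 1),
      X ^ (2 * k) * (((1 + X : ℚ⟦X⟧) ^ (2 * (m + 1) - k) * (1 + X)⁻¹ ^ (m + 1)) *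
        C ((2 * (m + 1)).choose k : ℚ)) := by
    rw [lagrangeKernel, mul_pow, ← pow_mul, add_comm (1 + X) (X ^ 2), add_pow, Finset.sum_mul]
    refine Finset.sum_congr rfl fun k _ => ?_
    rw [map_natCast, ← pow_mul]
    ring
  rw [h, map_sum]
  have hsub : Finset.range (m + 1 + 1) ⊆ Finset.range (2 * (m + 1) + 1) :=
    Finset.range_subset_range.2 (by omega)
  rw [← Finset.sum_subset hsub]
  · refine Finset.sum_congr rfl fun k hk => ?_
    have hk' : k ≤ m + 1 := by simpa [Nat.lt_succ_iff] using hk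
    have hpow : (1 + X : ℚ⟦X⟧) ^ (2 * (m + 1) - k) * (1 + X)⁻¹ ^ (m + 1) =
        (1 + X) ^ (m + 1 - k) := by
      rw [show 2 * (m + 1) - k = (m + 1 - k) + (m + 1) by omega, pow_add, mul_assoc, ← mul_pow,
        one_add_X_mul_inv, one_pow, mul_one]
    rw [hpow, coeff_X_pow_mul']
    split_ifs with hkm
    · rw [coeff_mul_C, ← Polynomial.coe_one, ← Polynomial.coe_X, ← Polynomial.coe_add,
        ← Polynomial.coe_pow, Polynomial.coeff_coe, Polynomial.coeff_one_add_X_pow, mul_comm,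
        Nat.choose_symm_of_eq_add (show m + 1 - k = (m - 2 * k) + (k + 1) by omega)]
    · rw [Nat.choose_eq_zero_of_lt (show m + 1 - k < k + 1 by omega)]
      simp
  · intro k _ hk
    rw [Finset.mem_range, not_lt] at hk
    rw [coeff_X_pow_mul', if_neg (by omega)]

end PowerSeriesLemmas

lemma isGWalk_conditions_append (s : List ℤ) (d : ℤ) :
    (∀ i, 1 ≤ i → i ≤ (s ++ [d]).length → 0 < ht (s ++ [d]) i) ↔
      (∀ i, 1 ≤ i → i ≤ s.length → 0 < ht s i) ∧ 0 < s.sum + d := by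
  have hlt : ∀ i ≤ s.length, ht (s ++ [d]) i = ht s i := fun i hi => by
    simp [ht, List.take_append_of_le_length hi]
  have hlast : ht (s ++ [d]) (s.length + 1) = s.sum + d := by
    have : (s ++ [d]).take (s.length + 1) = s ++ [d] := List.take_of_length_le (by simp)
    simp [ht, this]
  rw [List.length_append, List.length_singleton]
  constructor
  · intro h
    exact ⟨fun i h₁ h₂ => hlt i h₂ ▸ h i h₁ (by omega), hlast ▸ h _ (by omega) le_rfl⟩
  · rintro ⟨h, h'⟩ i h₁ h₂
    rcases Nat.lt_or_ge s.length i with hi | hi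
    · rw [show i = s.length + 1 by omega, hlast]
      exact h'
    · rw [hlt i hi]
      exact h i h₁ hi

lemma mem_positiveWalks (n : ℕ) (h : ℤ) (s : List ℤ) :
    s ∈ positiveWalks n h ↔ IsBasketball s ∧ s.sum = h ∧
      (∀ i, 1 ≤ i → i ≤ s.length → 0 < ht s i) ∧ s.length = n := by
  induction n generalizing h s with
  | zero =>
    rw [List.length_eq_zero_iff]
    constructor
    · intro hs
      have : h = 0 ∧ s = [] := by
        by_cases h0 : h = 0 <;> simp_all [positiveWalks]
      obtain ⟨rfl, rfl⟩ := this
      refine ⟨by simp [IsBasketball], rfl, fun i h₁ h₂ => ?_, rfl⟩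
      simp at h₂
      omega
    · rintro ⟨-, rfl, -, rfl⟩
      simp [positiveWalks]
  | succ n ih =>
    rcases s.eq_nil_or_concat' with rfl | ⟨t, d, rfl⟩
    · simp only [positiveWalks]
      split_ifs <;> simp
    · have hmem : t ++ [d] ∈ positiveWalks (n + 1) h ↔
          0 < h ∧ (d = -2 ∨ d = -1 ∨ d = 1 ∨ d = 2) ∧ t ∈ positiveWalks n (h - d) := by
        rw [positiveWalks]
        split_ifs with hh
        · simp only [Finset.mem_biUnion, Finset.mem_image]
          constructor
          · rintro ⟨e, he, u, hu, hue⟩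
            obtain ⟨rfl, hde⟩ := List.append_inj' hue rfl
            obtain rfl : e = d := by simpa using hde
            exact ⟨hh, by simpa using he, hu⟩
          · rintro ⟨-, hd, hmt⟩
            exact ⟨d, by simpa using hd, t, hmt, rfl⟩
        · simp [hh]
      rw [hmem, ih, isGWalk_conditions_append]
      have hbb : IsBasketball (t ++ [d]) ↔
          IsBasketball t ∧ (d = -2 ∨ d = -1 ∨ d = 1 ∨ d = 2) := by
        simp only [IsBasketball, List.mem_append, List.mem_singleton]
        constructor
        · exact fun H => ⟨fun x hx => H x (.inl hx), H d (.inr rfl)⟩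
        · rintro ⟨H, hd⟩ x (hx | rfl)
          exacts [H x hx, hd]
      have hsum : (t ++ [d]).sum = t.sum + d := by simp
      have hlen : (t ++ [d]).length = t.length + 1 := by simp
      rw [hbb, hsum, hlen]
      constructor
      · rintro ⟨hh, hd, hb, hs, hp, hl⟩
        exact ⟨⟨hb, hd⟩, by omega, ⟨hp, by omega⟩, by omega⟩
      · rintro ⟨⟨hb, hd⟩, hs, ⟨hp, hp'⟩, hl⟩
        exact ⟨by omega, hd, hb, by omega, hp, by omega⟩

lemma card_positiveWalks_succ (n : ℕ) {h : ℤ} (hh : 0 < h) :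
    (positiveWalks (n + 1) h).card =
      (positiveWalks n (h - 2)).card + (positiveWalks n (h - 1)).card +
        (positiveWalks n (h + 1)).card + (positiveWalks n (h + 2)).card := by
  rw [positiveWalks, if_pos hh, Finset.card_biUnion]
  · have hcard : ∀ d : ℤ, ((positiveWalks n (h - d)).image fun s => s ++ [d]).card =
        (positiveWalks n (h - d)).card := fun d =>
      Finset.card_image_of_injective _ (List.append_left_injective [d])
    simp only [hcard]
    rw [Finset.sum_insert (by simp), Finset.sum_insert (by simp), Finset.sum_insert (by simp),
      Finset.sum_singleton, sub_neg_eq_add, sub_neg_eq_add]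
    ring
  · intro d _ e _ hde
    rw [Function.onFun, Finset.disjoint_left]
    intro s hs hs'
    obtain ⟨t, -, rfl⟩ := Finset.mem_image.1 hs
    obtain ⟨u, -, hu⟩ := Finset.mem_image.1 hs'
    exact hde (by simpa using (List.append_inj' hu rfl).2.symm)

lemma positiveWalks_succ_of_nonpos (n : ℕ) {h : ℤ} (hh : h ≤ 0) :
    positiveWalks (n + 1) h = ∅ := by
  rw [positiveWalks, if_neg hh.not_gt]

lemma card_positiveWalks (n j : ℕ) :
    ((positiveWalks n (j - 1)).card : ℚ) = lagrangeCoeff n (heightSeries j) := by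
  induction n generalizing j with
  | zero =>
    rw [lagrangeCoeff_zero_left]
    match j with
    | 0 => simp [positiveWalks, heightSeries]
    | 1 => simp [positiveWalks, heightSeries]
    | j + 2 =>
      rw [constantCoeff_heightSeries, positiveWalks, if_neg (by push_cast; omega)]
      simp
  | succ n ih =>
    match j with
    | 0 =>
      rw [positiveWalks_succ_of_nonpos n (by simp), heightSeries, lagrangeCoeff_zero_right]
      simp
    | 1 =>
      rw [positiveWalks_succ_of_nonpos n (by simp), heightSeries, lagrangeCoeff_succ_one]
      simp
    | j + 2 =>
      rw [card_positiveWalks_succ n (by push_cast; omega), heightSeries_kernel_equation,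
        lagrangeCoeff_succ_X_mul_inv_mul, lagrangeCoeff_add, lagrangeCoeff_add,
        lagrangeCoeff_add, ← ih, ← ih, ← ih, ← ih]
      push_cast
      ring_nf

lemma card_isGWalk (n : ℕ) :
    Nat.card {s : List ℤ // IsGWalk s ∧ s.length = n} = (positiveWalks n 1).card := by
  rw [← Nat.card_eq_finsetCard]
  refine Nat.card_congr (Equiv.subtypeEquivRight fun s => ?_)
  rw [mem_positiveWalks, IsGWalk, ht, List.take_length, and_assoc, and_assoc]

/-- Summatory formula for the number of `n`-step G-walks. -/
theorem stmt6 (n : ℕ) (hn : 1 ≤ n) :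
    n * Nat.card {s : List ℤ // IsGWalk s ∧ s.length = n} =
      ∑ k ∈ Finset.range (n + 1), Nat.choose (2 * n) k * Nat.choose (n - k) (k + 1) := by
  obtain ⟨m, rfl⟩ := Nat.exists_eq_add_of_le' hn
  have hcard : ((positiveWalks (m + 1) 1).card : ℚ) = lagrangeCoeff (m + 1) PowerSeries.X := by
    have h := card_positiveWalks (m + 1) 2
    norm_num [heightSeries] at h
    exact h
  have h : ((m + 1 : ℕ) * (positiveWalks (m + 1) 1).card : ℚ) =
      ∑ k ∈ Finset.range (m + 1 + 1),
        ((2 * (m + 1)).choose k * (m + 1 - k).choose (k + 1) : ℚ) := by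
    rw [hcard, ← coeff_lagrangeKernel_pow, ← succ_mul_lagrangeCoeff_succ_X]
    push_cast
    rfl
  rw [card_isGWalk]
  exact_mod_cast h
end

section
/- For every integer n ≥ 2, the number of nonnegative basketball walks of length n-1 from 0 to 0 (basketball excursions) is equal to (1/n)·∑_{k ≥ 0} binomial(2n, k)·binomial(n-k-2, k-1). -/
/-- Combinatorial binomial coefficient on integers: zero unless `0 ≤ b ≤ a`. -/
def ibinom (a b : ℤ) : ℤ :=
  if 0 ≤ b ∧ b ≤ a then (a.toNat.choose b.toNat : ℤ) else 0

open PowerSeries in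
/-- If `φ * t = X`, then `φ ^ (k + 1) * derivative ℚ t` has coefficient `1` or `0` at `X ^ k`,
according to whether `k = 0`. -/
lemma coeff_pow_mul_derivative {φ t : ℚ⟦X⟧} (h : φ * t = X) (ht : constantCoeff t = 0) (k : ℕ) :
    coeff k (φ ^ (k + 1) * derivative ℚ t) = if k = 0 then 1 else 0 := by
  have hd : φ * derivative ℚ t + t * derivative ℚ φ = 1 := by
    have := congrArg (derivative ℚ) h
    simpa [Derivation.leibniz, derivative_X] using this
  rcases k with _ | k
  · have := congrArg constantCoeff hd
    simpa [ht] using this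
  · have hpow : (C ((k : ℚ) + 1)) * (φ ^ (k + 2) * derivative ℚ t) =
        C ((k : ℚ) + 1) * φ ^ (k + 1) - X * derivative ℚ (φ ^ (k + 1)) := by
      rw [derivative_pow, ← h]
      have hc : C ((k : ℚ) + 1) = (k : ℚ⟦X⟧) + 1 := by simp
      rw [hc]
      push_cast
      linear_combination ((k : ℚ⟦X⟧) + 1) * φ ^ (k + 1) * hd
    have := congrArg (coeff (k + 1)) hpow
    rw [map_sub, coeff_C_mul, coeff_C_mul, coeff_succ_X_mul, coeff_derivative] at this
    have hk : ((k : ℚ) + 1) ≠ 0 := by positivity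
    have h0 : ((k : ℚ) + 1) * coeff (k + 1) (φ ^ (k + 2) * derivative ℚ t) = 0 := by
      rw [this]; ring
    simpa [hk] using h0

open PowerSeries in
/-- Lagrange inversion for a truncated expansion of `φ` in powers of `t = X / φ`. -/
lemma natCast_mul_eq_coeff_pow {φ t R : ℚ⟦X⟧} (h : φ * t = X) (ht : constantCoeff t = 0)
    (a : ℕ → ℚ) (m : ℕ)
    (hφ : φ = ∑ j ∈ Finset.range (m + 1), C (a j) * t ^ j + t ^ (m + 1) * R) :
    ((m : ℚ) + 1) * a m = coeff m (φ ^ (m + 1)) := by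
  have hX : ∑ j ∈ Finset.range (m + 1), C (a j) * t ^ (j + 1) + t ^ (m + 2) * R = X := by
    rw [← h]
    conv_rhs => rw [hφ]
    rw [add_mul, Finset.sum_mul]
    congr 1
    · exact Finset.sum_congr rfl fun j _ => by ring
    · ring
  have hd := congrArg (fun f => φ ^ (m + 1) * derivative ℚ f) hX
  simp only [map_add, map_sum, Derivation.leibniz, derivative_pow, derivative_C, derivative_X,
    smul_eq_mul, mul_zero, add_zero, mul_one, Nat.add_sub_cancel, mul_add, Finset.mul_sum] at hd
  have hterm (j : ℕ) (hj : j ∈ Finset.range (m + 1)) :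
      coeff m (φ ^ (m + 1) * (C (a j) * (((j + 1 : ℕ) : ℚ⟦X⟧) * t ^ j * derivative ℚ t))) =
        if j = m then ((m : ℚ) + 1) * a m else 0 := by
    obtain ⟨k, rfl⟩ := Nat.exists_eq_add_of_le (Nat.lt_succ_iff.1 (Finset.mem_range.1 hj))
    have : φ ^ (j + k + 1) * (C (a j) * (((j + 1 : ℕ) : ℚ⟦X⟧) * t ^ j * derivative ℚ t)) =
        C (((j : ℚ) + 1) * a j) * (X ^ j * (φ ^ (k + 1) * derivative ℚ t)) := by
      rw [← h]
      simp only [map_mul, map_add, map_natCast, map_one]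
      push_cast
      ring
    rw [this, coeff_C_mul, add_comm j k, coeff_X_pow_mul, coeff_pow_mul_derivative h ht]
    rcases eq_or_ne k 0 with rfl | hk
    · simp
    · simp [hk]
  have hr (f : ℚ⟦X⟧) : coeff m (φ ^ (m + 1) * (t ^ (m + 1) * f)) = 0 := by
    rw [← mul_assoc, ← mul_pow, h, coeff_X_pow_mul', if_neg (by omega)]
  have hc := congrArg (coeff m) hd
  rw [map_add, map_add, map_sum, Finset.sum_congr rfl hterm] at hc
  have e1 : t ^ (m + 2) * derivative ℚ R = t ^ (m + 1) * (t * derivative ℚ R) := by ring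
  have e2 : R * (((m + 2 : ℕ) : ℚ⟦X⟧) * t ^ (m + 2 - 1) * derivative ℚ t) =
      t ^ (m + 1) * (R * ((m + 2 : ℕ) : ℚ⟦X⟧) * derivative ℚ t) := by
    rw [show m + 2 - 1 = m + 1 from rfl]; ring
  rw [e1, e2, hr, hr] at hc
  simpa using hc

/-- The step lists of the nonnegative basketball walks of length `n` from `h` to `0`. -/
def walksToZero : ℕ → ℤ → Finset (List ℤ)
  | 0, h => if h = 0 then {[]} else ∅
  | n + 1, h => if h < 0 then ∅ else
      ({-2, -1, 1, 2} : Finset ℤ).biUnion fun x => (walksToZero n (h + x)).image (List.cons x)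

lemma mem_walksToZero (n : ℕ) (h : ℤ) (s : List ℤ) :
    s ∈ walksToZero n h ↔ (IsBasketball s ∧ h + ht s s.length = 0 ∧
      ∀ i, i ≤ s.length → 0 ≤ h + ht s i) ∧ s.length = n := by
  induction n generalizing h s with
  | zero =>
    rw [walksToZero, List.length_eq_zero_iff]
    constructor
    · intro hs
      split_ifs at hs with h0
      · simp only [Finset.mem_singleton] at hs
        subst hs h0
        simp [IsBasketball, ht]
      · simp at hs
    · rintro ⟨⟨-, h0, -⟩, rfl⟩
      have : h = 0 := by simpa [ht] using h0
      simp [this]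
  | succ n ih =>
    have htc (x : ℤ) (l : List ℤ) (i : ℕ) : ht (x :: l) (i + 1) = x + ht l i := by simp [ht]
    rw [walksToZero]
    constructor
    · intro hs
      split_ifs at hs with h0
      · simp at hs
      · simp only [Finset.mem_biUnion, Finset.mem_image] at hs
        obtain ⟨x, hx, l, hl, rfl⟩ := hs
        obtain ⟨⟨hb, he, hp⟩, hn⟩ := (ih _ _).1 hl
        refine ⟨⟨?_, ?_, ?_⟩, by simp [hn]⟩
        · intro y hy
          rcases List.mem_cons.1 hy with rfl | hy
          · simpa using hx
          · exact hb y hy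
        · rw [List.length_cons, htc]; linarith
        · rintro (_ | i) hi
          · simp [ht]; linarith
          · rw [htc, ← add_assoc]
            exact hp i (by simpa using hi)
    · rintro ⟨⟨hb, he, hp⟩, hn⟩
      rcases s with _ | ⟨x, l⟩
      · simp at hn
      have h0 : 0 ≤ h := by simpa [ht] using hp 0 (by simp)
      rw [if_neg (not_lt.2 h0)]
      simp only [Finset.mem_biUnion, Finset.mem_image]
      refine ⟨x, by simpa using hb x (by simp), l, (ih _ _).2 ⟨⟨?_, ?_, ?_⟩, by simpa using hn⟩, rfl⟩
      · exact fun y hy => hb y (by simp [hy])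
      · rw [List.length_cons, htc] at he; linarith
      · intro i hi
        have := hp (i + 1) (by simpa using hi)
        rwa [htc, ← add_assoc] at this

lemma card_walksToZero_of_neg (n : ℕ) {h : ℤ} (hh : h < 0) : (walksToZero n h).card = 0 := by
  cases n <;> simp [walksToZero, hh, hh.ne]

lemma card_walksToZero_succ (n : ℕ) {h : ℤ} (hh : 0 ≤ h) :
    (walksToZero (n + 1) h).card = (walksToZero n (h - 2)).card + (walksToZero n (h - 1)).card +
      (walksToZero n (h + 1)).card + (walksToZero n (h + 2)).card := by
  rw [walksToZero, if_neg (not_lt.2 hh), Finset.card_biUnion]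
  · simp [Finset.card_image_of_injective _ (List.cons_injective), ← sub_eq_add_neg, add_assoc]
  · intro x _ y _ hxy
    rw [Function.onFun, Finset.disjoint_left]
    intro s hs hs'
    simp only [Finset.mem_image] at hs hs'
    obtain ⟨l, -, rfl⟩ := hs
    obtain ⟨l', -, h'⟩ := hs'
    exact hxy (List.cons.inj h').1.symm

/-- A solution of the first-step equations agrees, up to order `N` in `t`, with the generating
series of nonnegative walks ending at `0`. -/
lemma exists_eq_sum_card_walksToZero {A : Type*} [CommRing A] (t : A) (V : ℤ → A)
    (hneg : ∀ h < 0, V h = 0)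
    (hV : ∀ h, 0 ≤ h → V h = (if h = 0 then 1 else 0) +
      t * (V (h - 2) + V (h - 1) + V (h + 1) + V (h + 2))) (N : ℕ) :
    ∃ R : ℤ → A, ∀ h, V h =
      ∑ n ∈ Finset.range N, ((walksToZero n h).card : A) * t ^ n + t ^ N * R h := by
  induction N with
  | zero => exact ⟨V, by simp⟩
  | succ N ih =>
    obtain ⟨R, hR⟩ := ih
    refine ⟨fun h => if h < 0 then 0 else R (h - 2) + R (h - 1) + R (h + 1) + R (h + 2),
      fun h => ?_⟩
    rcases lt_or_ge h 0 with hh | hh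
    · simp [hneg h hh, hh, card_walksToZero_of_neg]
    · have h0 : ((walksToZero 0 h).card : A) = if h = 0 then 1 else 0 := by
        rw [walksToZero]; split_ifs <;> simp
      rw [hV h hh, Finset.sum_range_succ', h0, hR (h - 2), hR (h - 1),
        hR (h + 1), hR (h + 2)]
      simp only [if_neg (not_lt.2 hh), card_walksToZero_succ _ hh, Nat.cast_add, add_mul, Finset.sum_add_distrib,
        pow_succ, ← mul_assoc, ← Finset.sum_mul]
      ring

/-- The sequence with generating function `1 / (1 - a u - b u ^ 2)`. -/
def recSeq {A : Type*} [CommRing A] (a b : A) : ℕ → A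
  | 0 => 1
  | 1 => a
  | h + 2 => a * recSeq a b (h + 1) + b * recSeq a b h

lemma recSeq_kernel {A : Type*} [CommRing A] {a b t : A} (hab : b = a * (1 - b))
    (ht : (1 + b * a) ^ 2 * t = b) (V : ℤ → A)
    (hV : V = fun h => if h < 0 then 0 else (1 + b * a) ^ 2 * recSeq a b h.toNat) (h : ℤ)
    (hh : 0 ≤ h) :
    V h = (if h = 0 then 1 else 0) + t * (V (h - 2) + V (h - 1) + V (h + 1) + V (h + 2)) := by
  have hn (n : ℕ) : V n = (1 + b * a) ^ 2 * recSeq a b n := by simp [hV]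
  have h1 : V (-1) = 0 := by simp [hV]
  have h2 : V (-2) = 0 := by simp [hV]
  lift h to ℕ using hh
  match h with
  | 0 =>
    have e0 := hn 0
    have e1 := hn 1
    have e2 := hn 2
    simp only [recSeq] at e0 e1 e2
    push_cast at *
    norm_num [h1, h2, e0, e1, e2]
    linear_combination (-(a + a ^ 2 + b)) * ht + (a * b - b) * hab
  | 1 =>
    have e0 := hn 0
    have e1 := hn 1
    have e2 := hn 2
    have e3 := hn 3
    simp only [recSeq] at e0 e1 e2 e3
    push_cast at *
    norm_num [h1, e0, e1, e2, e3]
    linear_combination (-(1 + (a * a + b) + (a * (a * a + b) + b * a))) * ht +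
      ((a * b - b) * a - (1 + b)) * hab
  | n + 2 =>
    have e0 := hn n
    have e1 := hn (n + 1)
    have e2 := hn (n + 2)
    have e3 := hn (n + 3)
    have e4 := hn (n + 4)
    simp only [recSeq] at e0 e1 e2 e3 e4
    rw [show ((n + 2 : ℕ) : ℤ) - 2 = n by push_cast; ring,
      show ((n + 2 : ℕ) : ℤ) - 1 = (n + 1 : ℕ) by push_cast; ring,
      show ((n + 2 : ℕ) : ℤ) + 1 = (n + 3 : ℕ) by push_cast; ring,
      show ((n + 2 : ℕ) : ℤ) + 2 = (n + 4 : ℕ) by push_cast; ring,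
      if_neg (by omega), e0, e1, e2, e3, e4]
    set p := recSeq a b n
    set q := recSeq a b (n + 1)
    linear_combination (-(p + q + (a * (a * q + b * p) + b * q) +
      (a * (a * (a * q + b * p) + b * q) + b * (a * q + b * p)))) * ht +
      ((a * b - b) * (a * q + b * p) - q * (1 + b)) * hab

open PowerSeries in
lemma coeff_one_add_mul_pow {a : ℚ⟦X⟧} (ha : X = a * (1 - X)) (n : ℕ) (hn : 2 ≤ n) :
    coeff (n - 1) ((1 + X * a) ^ (2 * n)) = ((∑ k ∈ Finset.range (n + 1),
      ibinom (2 * n) k * ibinom ((n : ℤ) - k - 2) ((k : ℤ) - 1) : ℤ) : ℚ) := by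
  have hpow (j : ℕ) : a ^ (j + 1) = X ^ (j + 1) * mk fun i => ((j + i).choose j : ℚ) := by
    conv_rhs => rw [ha, mul_pow, mul_assoc, mul_comm ((1 - X) ^ (j + 1))]
    rw [mk_add_choose_mul_one_sub_pow_eq_one, mul_one]
  have hterm (k : ℕ) (hk : k ∈ Finset.range (2 * n + 1)) :
      coeff (n - 1) ((X * a) ^ k * 1 ^ (2 * n - k) * ((2 * n).choose k : ℚ⟦X⟧)) =
        ((ibinom (2 * n) k * ibinom ((n : ℤ) - k - 2) ((k : ℤ) - 1) : ℤ) : ℚ) := by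
    have hk' : k ≤ 2 * n := Nat.lt_succ_iff.1 (Finset.mem_range.1 hk)
    have hb : ibinom (2 * n) k = (2 * n).choose k := by
      rw [ibinom, if_pos (by omega), show (2 * (n : ℤ)).toNat = 2 * n by omega, Int.toNat_natCast]
    rcases k with _ | j
    · have : n - 1 ≠ 0 := by omega
      simp [ibinom, coeff_one, this]
    · have hX : (X * a) ^ (j + 1) * 1 ^ (2 * n - (j + 1)) * ((2 * n).choose (j + 1) : ℚ⟦X⟧) =
          C ((2 * n).choose (j + 1) : ℚ) *
            (X ^ (2 * j + 2) * mk fun i => ((j + i).choose j : ℚ)) := by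
        rw [mul_pow, hpow, map_natCast]
        ring
      rw [hX, coeff_C_mul, coeff_X_pow_mul', coeff_mk, hb, Int.cast_mul, Int.cast_natCast, ibinom]
      congr 1
      by_cases hj : 2 * j + 2 ≤ n - 1
      · rw [if_pos hj, if_pos (by omega), Int.cast_natCast]
        congr 2 <;> omega
      · rw [if_neg hj, if_neg (by omega), Int.cast_zero]
  rw [add_comm, add_pow, map_sum, Finset.sum_congr rfl hterm, Int.cast_sum]
  refine (Finset.sum_subset (Finset.range_mono (by omega)) fun k _ hk => ?_).symm
  rw [Finset.mem_range, not_lt] at hk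
  rw [ibinom.eq_def ((n : ℤ) - k - 2), if_neg (by omega), mul_zero, Int.cast_zero]

open PowerSeries in
/-- Summatory formula for the number of basketball excursions of length `n - 1`. -/
theorem stmt8 (n : ℕ) (hn : 2 ≤ n) :
    (n : ℤ) * Nat.card {s : List ℤ // IsAWalk s ∧ s.length = n - 1} =
      ∑ k ∈ Finset.range (n + 1),
        ibinom (2 * n) k * ibinom ((n : ℤ) - k - 2) ((k : ℤ) - 1) := by
  have hcard : Nat.card {s : List ℤ // IsAWalk s ∧ s.length = n - 1} =
      (walksToZero (n - 1) 0).card := by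
    refine Nat.subtype_card _ fun s => ?_
    simp [mem_walksToZero, IsAWalk]
  obtain ⟨m, rfl⟩ : ∃ m, n = m + 1 := ⟨n - 1, by omega⟩
  set a : ℚ⟦X⟧ := X * mk 1 with ha
  have hab : X = a * (1 - X) := by
    rw [ha, mul_assoc, mk_one_mul_one_sub_eq_one, mul_one]
  set φ : ℚ⟦X⟧ := (1 + X * a) ^ 2 with hφ
  have hφ0 : constantCoeff φ ≠ 0 := by simp [hφ]
  have ht : φ * (X * φ⁻¹) = X := by
    rw [mul_left_comm, PowerSeries.mul_inv_cancel _ hφ0, mul_one]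
  set V : ℤ → ℚ⟦X⟧ := fun h => if h < 0 then 0 else φ * recSeq a X h.toNat with hV
  obtain ⟨R, hR⟩ := exists_eq_sum_card_walksToZero (X * φ⁻¹) V (fun h hh => by simp [hV, hh])
    (recSeq_kernel hab ht V hV) (m + 1)
  have hV0 : V 0 = φ := by simp [hV, recSeq]
  have hmain := natCast_mul_eq_coeff_pow ht (by simp) (fun j => ((walksToZero j 0).card : ℚ)) m
    (R := R 0) (by simpa [hV0] using hR 0)
  have hcoeff := coeff_one_add_mul_pow hab (m + 1) hn
  rw [Nat.add_sub_cancel, pow_mul, ← hφ, ← hmain] at hcoeff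
  rw [hcard, ← Int.cast_inj (α := ℚ), ← hcoeff]
  simp
end
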